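/- For every entire function f : ℂ → ℂ, the commutator identity 𝒜_W(𝒟_W f) − 𝒟_W(𝒜_W f) = (1/2)·𝒟_W(𝒟_W f) holds identically on ℂ. -/

import Mathlib

open Complex

/-- The Wilson divided-difference operator `𝒟_W`.  For `x ≠ 0` the value is
`(f((√x + i/2)²) - f((√x - i/2)²)) / (2 i √x)` (independent of the chosen square root);
at `x = 0` it is the limiting value `f'(-1/4)`.  For entire `f` this function is the
entire extension of the Wilson difference of `f`. -/
noncomputable def wilsonD (f : ℂ → ℂ) (x : ℂ) : ℂ :=
  if x = 0 then deriv f (-(1/4) : ℂ)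
  else (f ((x ^ ((1:ℂ)/2) + I/2)^2) - f ((x ^ ((1:ℂ)/2) - I/2)^2)) / (2 * I * x ^ ((1:ℂ)/2))

/-- The Wilson averaging operator `𝒜_W`, with its limiting value `f(-1/4)` at `x = 0`. -/
noncomputable def wilsonA (f : ℂ → ℂ) (x : ℂ) : ℂ :=
  if x = 0 then f (-(1/4) : ℂ)
  else (f ((x ^ ((1:ℂ)/2) + I/2)^2) + f ((x ^ ((1:ℂ)/2) - I/2)^2)) / 2

theorem wilsonA_sq (f : ℂ → ℂ) (z : ℂ) :
    wilsonA f (z ^ 2) = (f ((z + I / 2) ^ 2) + f ((z - I / 2) ^ 2)) / 2 := by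
  unfold wilsonA
  split_ifs with h
  · obtain rfl : z = 0 := by simpa using h
    have h₁ : (0 + I / 2) ^ 2 = -(1 / 4 : ℂ) := by linear_combination I_sq / 4
    have h₂ : (0 - I / 2) ^ 2 = -(1 / 4 : ℂ) := by linear_combination I_sq / 4
    rw [h₁, h₂]
    ring
  · have hw : ((z ^ 2) ^ ((1 : ℂ) / 2)) ^ 2 = z ^ 2 := by simp
    rcases sq_eq_sq_iff_eq_or_eq_neg.mp hw with h' | h' <;> rw [h']
    rw [show (-z + I / 2) ^ 2 = (z - I / 2) ^ 2 by ring,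
      show (-z - I / 2) ^ 2 = (z + I / 2) ^ 2 by ring]
    ring

theorem wilsonD_sq (f : ℂ → ℂ) {z : ℂ} (hz : z ≠ 0) :
    wilsonD f (z ^ 2) = (f ((z + I / 2) ^ 2) - f ((z - I / 2) ^ 2)) / (2 * I * z) := by
  have hw : ((z ^ 2) ^ ((1 : ℂ) / 2)) ^ 2 = z ^ 2 := by simp
  rw [wilsonD, if_neg (pow_ne_zero 2 hz)]
  rcases sq_eq_sq_iff_eq_or_eq_neg.mp hw with h' | h' <;> rw [h']
  rw [show (-z + I / 2) ^ 2 = (z - I / 2) ^ 2 by ring,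
    show (-z - I / 2) ^ 2 = (z + I / 2) ^ 2 by ring]
  field_simp
  ring

/-- A function is entire as soon as its composition with squaring is. -/
theorem differentiable_of_comp_sq {h : ℂ → ℂ} (hh : Differentiable ℂ fun z => h (z ^ 2)) :
    Differentiable ℂ h := by
  have hsq (y : ℂ) : (y ^ ((1 : ℂ) / 2)) ^ 2 = y := by simp
  have hne : ∀ x ≠ 0, DifferentiableAt ℂ h x := by
    intro x hx
    have heq : h = fun y => (fun z => h (z ^ 2))
        (x ^ ((1 : ℂ) / 2) * (y / x) ^ ((1 : ℂ) / 2)) := by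
      funext y
      simp only [mul_pow, hsq]
      rw [mul_div_cancel₀ _ hx]
    rw [heq]
    have hroot : DifferentiableAt ℂ (fun y : ℂ => (y / x) ^ ((1 : ℂ) / 2)) x :=
      (differentiableAt_id.div_const x).cpow_const (by simp [hx])
    exact (hh _).comp x (hroot.const_mul _)
  have hcont : ContinuousAt h 0 := by
    have heq : h = (fun z => h (z ^ 2)) ∘ fun y => y ^ ((1 : ℂ) / 2) := by
      funext y
      simp only [Function.comp, hsq]
    rw [heq]
    exact hh.continuous.continuousAt.comp
      (continuousAt_cpow_const_of_re_pos (by simp) (by norm_num))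
  have hdiff := (differentiableOn_compl_singleton_and_continuousAt_iff
    (Filter.univ_mem : Set.univ ∈ nhds (0 : ℂ))).mp
    ⟨fun x hx => (hne x (by simpa using hx)).differentiableWithinAt, hcont⟩
  exact differentiableOn_univ.mp hdiff

theorem differentiable_wilsonA {f : ℂ → ℂ} (hf : Differentiable ℂ f) :
    Differentiable ℂ (wilsonA f) := by
  apply differentiable_of_comp_sq
  simp only [wilsonA_sq]
  fun_prop

theorem differentiable_wilsonD {f : ℂ → ℂ} (hf : Differentiable ℂ f) :
    Differentiable ℂ (wilsonD f) := by
  apply differentiable_of_comp_sq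
  set G : ℂ → ℂ := fun z => f ((z + I / 2) ^ 2) - f ((z - I / 2) ^ 2) with hG
  have h₁ : (0 + I / 2) ^ 2 = -(1 / 4 : ℂ) := by linear_combination I_sq / 4
  have h₂ : (0 - I / 2) ^ 2 = -(1 / 4 : ℂ) := by linear_combination I_sq / 4
  have hG0 : G 0 = 0 := by simp only [hG, h₁, h₂, sub_self]
  have hGd : Differentiable ℂ G := by fun_prop
  have hderiv : deriv G 0 = 2 * I * deriv f (-(1 / 4)) := by
    have e₁ : HasDerivAt (fun z : ℂ => (z + I / 2) ^ 2) I 0 := by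
      simpa [mul_div_cancel₀] using
        ((hasDerivAt_id' (0 : ℂ)).add_const (I / 2)).fun_pow 2
    have e₂ : HasDerivAt (fun z : ℂ => (z - I / 2) ^ 2) (-I) 0 := by
      simpa [mul_div_cancel₀] using
        ((hasDerivAt_id' (0 : ℂ)).sub_const (I / 2)).fun_pow 2
    have d₁ := (h₁ ▸ (hf _).hasDerivAt : HasDerivAt f (deriv f (-(1 / 4))) ((0 + I / 2) ^ 2))
    have d₂ := (h₂ ▸ (hf _).hasDerivAt : HasDerivAt f (deriv f (-(1 / 4))) ((0 - I / 2) ^ 2))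
    refine ((d₁.comp (0 : ℂ) e₁).sub (d₂.comp (0 : ℂ) e₂)).deriv.trans ?_
    ring
  have heq : (fun z => wilsonD f (z ^ 2)) = fun z => dslope G 0 z / (2 * I) := by
    funext z
    rcases eq_or_ne z 0 with rfl | hz
    · rw [dslope_same, hderiv, mul_div_cancel_left₀ _ (by simp)]
      simp [wilsonD]
    · rw [wilsonD_sq f hz, dslope_of_ne _ hz, slope_def_field, hG0, sub_zero, sub_zero,
        div_div, mul_comm z]
  rw [heq]
  have hslope : Differentiable ℂ (dslope G 0) :=
    differentiableOn_univ.mp ((differentiableOn_dslope Filter.univ_mem).mpr hGd.differentiableOn)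
  exact hslope.div_const _

/-- **Commutator identity** `𝒜_W 𝒟_W - 𝒟_W 𝒜_W = (1/2) 𝒟_W²` for entire functions. -/
theorem wilson_commutator (f : ℂ → ℂ) (hf : Differentiable ℂ f) (x : ℂ) :
    wilsonA (wilsonD f) x - wilsonD (wilsonA f) x = (1/2) * wilsonD (wilsonD f) x := by
  suffices hfun : (fun z : ℂ => wilsonA (wilsonD f) (z ^ 2) - wilsonD (wilsonA f) (z ^ 2)) =
      fun z => (1 / 2) * wilsonD (wilsonD f) (z ^ 2) by
    have hsq : (x ^ ((1 : ℂ) / 2)) ^ 2 = x := by simp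
    simpa only [hsq] using congrFun hfun (x ^ ((1 : ℂ) / 2))
  have hdense : Dense ({0, I / 2, -(I / 2)} : Set ℂ)ᶜ :=
    (Set.toFinite _).countable.dense_compl ℝ
  have hAD := (differentiable_wilsonA (differentiable_wilsonD hf)).continuous
  have hDA := (differentiable_wilsonD (differentiable_wilsonA hf)).continuous
  have hDD := (differentiable_wilsonD (differentiable_wilsonD hf)).continuous
  refine Continuous.ext_on hdense (by fun_prop) (by fun_prop) fun z hz => ?_
  simp only [Set.mem_compl_iff, Set.mem_insert_iff, Set.mem_singleton_iff, not_or] at hz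
  obtain ⟨hz, hm, hp⟩ := hz
  replace hm : z - I / 2 ≠ 0 := sub_ne_zero.mpr hm
  replace hp : z + I / 2 ≠ 0 := fun h => hp (eq_neg_of_add_eq_zero_left h)
  simp only [wilsonA_sq, wilsonD_sq _ hz, wilsonD_sq _ hm, wilsonD_sq _ hp]
  rw [show z + I / 2 + I / 2 = z + I by ring, show z + I / 2 - I / 2 = z by ring,
    show z - I / 2 + I / 2 = z by ring, show z - I / 2 - I / 2 = z - I by ring]
  generalize f ((z + I) ^ 2) = a, f (z ^ 2) = b, f ((z - I) ^ 2) = c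
  have key (u v : ℂ) (hu : u ≠ 0) (hv : v ≠ 0) (hzu : z = u - I / 2) (hzv : z = v + I / 2) :
      ((a - b) / (2 * I * u) + (b - c) / (2 * I * v)) / 2 -
        ((a + b) / 2 - (b + c) / 2) / (2 * I * z) =
      1 / 2 * (((a - b) / (2 * I * u) - (b - c) / (2 * I * v)) / (2 * I * z)) := by
    have hI := I_ne_zero
    field_simp
    linear_combination (2 * I * v * a - 2 * I * z * b - b) * hzu +
      (2 * I * z * b - b - 2 * I * u * c) * hzv + (2 * z * b - v * a - u * c) * I_sq
  exact key _ _ hp hm (by ring) (by ring)
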